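/- Let n ≥ 2 and let X ⊂ ℝ^n be a Cantor set. Then the complement ℝ^n \ X is a connected subset of ℝ^n. -/

import Mathlib

/-- A Cantor set in a topological space: a nonempty, compact, perfect
(no isolated points), totally disconnected subset. -/
def IsCantorSet {α : Type*} [TopologicalSpace α] (X : Set α) : Prop :=
  X.Nonempty ∧ IsCompact X ∧ Perfect X ∧ IsTotallyDisconnected X

open Set Topology Metric

/-- Every open set whose frontier lies in `K` and which contains `p` also contains `q`:
for closed `K` not containing `p` and `q`, no open partition of `Kᶜ` separates `p` from `q`. -/
def NotSeparates {E : Type*} [TopologicalSpace E] (K : Set E) (p q : E) : Prop :=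
  ∀ U : Set E, IsOpen U → frontier U ⊆ K → p ∈ U → q ∈ U

section TopologicalSpace

variable {E : Type*} [TopologicalSpace E]

theorem notSeparates_empty [PreconnectedSpace E] (p q : E) : NotSeparates ∅ p q := by
  intro U _ hU hp
  rcases frontier_eq_empty_iff.1 (subset_empty_iff.1 hU) with rfl | rfl
  · exact hp.elim
  · trivial

theorem NotSeparates.of_isPreconnected {K C : Set E} {p q : E} (hC : IsPreconnected C)
    (hCK : Disjoint C K) (hp : p ∈ C) (hq : q ∈ C) : NotSeparates K p q := by
  intro U hUo hU hpU
  have h : C ⊆ U ∪ (closure U)ᶜ := by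
    intro z hz
    by_contra hzU
    simp only [mem_union, mem_compl_iff, not_or, not_not] at hzU
    exact disjoint_left.1 hCK hz (hU (by rw [hUo.frontier_eq]; exact ⟨hzU.2, hzU.1⟩))
  refine hC.subset_left_of_subset_union hUo isClosed_closure.isOpen_compl ?_ h ⟨p, hp, hpU⟩ hq
  exact disjoint_compl_right.mono_left subset_closure

theorem isPreconnected_compl_of_notSeparates {K : Set E} (hK : IsClosed K)
    (h : ∀ p ∉ K, ∀ q ∉ K, NotSeparates K p q) : IsPreconnected Kᶜ := by
  rintro u v hu hv huv ⟨p, hpK, hpu⟩ ⟨q, hqK, hqv⟩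
  by_contra hne
  have hdisj : ∀ z ∉ K, z ∈ u → z ∉ v := fun z hz hzu hzv => hne ⟨z, hz, hzu, hzv⟩
  have hfr : frontier (u ∩ Kᶜ) ⊆ K := by
    intro z hz
    by_contra hzK
    rw [(hu.inter hK.isOpen_compl).frontier_eq] at hz
    rcases huv hzK with hzu | hzv
    · exact hz.2 ⟨hzu, hzK⟩
    · obtain ⟨y, hyv, hyu, hyK⟩ := mem_closure_iff.1 hz.1 v hv hzv
      exact hdisj y hyK hyu hyv
  exact hdisj q hqK (h p hpK q hqK _ (hu.inter hK.isOpen_compl) hfr ⟨hpu, hpK⟩).1 hqv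

theorem NotSeparates.eq_of_continuousOn {K : Set E} {p q : E} (h : NotSeparates K p q)
    (hK : IsClosed K) (hp : p ∉ K) {k : E → ℝ} (hk : ContinuousOn k Kᶜ)
    (hint : ∀ z, ∃ m : ℤ, k z = m) : k q = k p := by
  have heq : Kᶜ ∩ k ⁻¹' ball (k p) 1 = Kᶜ ∩ k ⁻¹' {k p} := by
    ext z
    obtain ⟨m, hm⟩ := hint z
    obtain ⟨l, hl⟩ := hint p
    simp only [mem_inter_iff, mem_preimage, mem_ball, mem_singleton_iff, hm, hl,
      Int.dist_cast_real, Int.dist_eq]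
    norm_cast
    simp only [Int.abs_lt_one_iff, sub_eq_zero]
  have hW : IsOpen (Kᶜ ∩ k ⁻¹' {k p}) :=
    heq ▸ hk.isOpen_inter_preimage hK.isOpen_compl isOpen_ball
  refine (h _ hW ?_ ⟨hp, rfl⟩).2
  intro z hz
  by_contra hzK
  rw [hW.frontier_eq] at hz
  have hV : IsOpen (Kᶜ ∩ k ⁻¹' {k p}ᶜ) :=
    hk.isOpen_inter_preimage hK.isOpen_compl isOpen_compl_singleton
  obtain ⟨y, hy, hy'⟩ := mem_closure_iff.1 hz.1 _ hV ⟨hzK, fun hzp => hz.2 ⟨hzK, hzp⟩⟩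
  exact hy.2 hy'.2

open Classical in
/-- Janiszewski's theorem in simply connected spaces. -/
theorem NotSeparates.union [SimplyConnectedSpace E] [LocallyPathConnectedSpace E]
    [NormalSpace E] {A B : Set E} {p q : E} (hA : IsClosed A) (hB : IsClosed B)
    (hAB : Disjoint A B) (hpA : p ∉ A) (hpB : p ∉ B) (h₁ : NotSeparates A p q)
    (h₂ : NotSeparates B p q) : NotSeparates (A ∪ B) p q := by
  intro U hUo hU hpU
  by_contra hqU
  obtain ⟨φ, hφA, hφB, -⟩ := exists_continuous_zero_one_of_isClosed hA hB hAB
  let g : E → AddCircle (1 : ℝ) := U.piecewise (fun z => (φ z : AddCircle (1 : ℝ))) 0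
  have hg : Continuous g := by
    refine Continuous.piecewise (fun z hz => ?_)
      ((AddCircle.continuous_mk' 1).comp φ.continuous) continuous_const
    rcases hU hz with hzA | hzB
    · simp [hφA hzA]
    · simp [hφB hzB]
  obtain ⟨t, ht⟩ := QuotientAddGroup.mk_surjective (g p)
  obtain ⟨F, ⟨-, hF⟩, -⟩ := (AddCircle.isCoveringMap_coe (1 : ℝ)).existsUnique_continuousMap_lifts
    ⟨g, hg⟩ p t ht
  have hFg : ∀ z, ((F z : ℝ) : AddCircle (1 : ℝ)) = g z := congrFun hF
  have key (c : ℤ) (K : Set E) (hK : IsClosed K) (hpK : p ∉ K) (hKpq : NotSeparates K p q)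
      (hc : ∀ z ∈ frontier U, z ∉ K → φ z = c) : F q = F p - (φ p - c) := by
    have hk := hKpq.eq_of_continuousOn hK hpK
      (k := fun z => F z - U.piecewise (fun z => φ z - (c : ℝ)) 0 z) ?_ ?_
    · simpa [hpU, hqU] using hk
    · refine F.continuous.continuousOn.sub (ContinuousOn.piecewise (fun z hz => ?_) ?_ ?_)
      · simp [hc z hz.2 hz.1]
      · fun_prop
      · exact continuousOn_const
    · intro z
      have hz : ((F z - U.piecewise (fun z => φ z - (c : ℝ)) 0 z : ℝ) : AddCircle (1 : ℝ)) = 0 := by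
        have hc' : ((c : ℝ) : AddCircle (1 : ℝ)) = 0 :=
          (AddCircle.coe_eq_zero_iff 1).2 ⟨c, by simp⟩
        rw [AddCircle.coe_sub, hFg]
        by_cases hzU : z ∈ U <;> simp [g, hzU, hc']
      obtain ⟨m, hm⟩ := (AddCircle.coe_eq_zero_iff 1).1 hz
      exact ⟨m, by simpa using hm.symm⟩
  have e₀ := key 0 B hB hpB h₂ fun z hz hzB => by
    simpa using hφA ((hU hz).resolve_right hzB)
  have e₁ := key 1 A hA hpA h₁ fun z hz hzA => by
    simpa using hφB ((hU hz).resolve_left hzA)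
  push_cast at e₀ e₁
  linarith

theorem exists_isClosed_diff_subset_of_isTotallyDisconnected [T2Space E] {X V : Set E}
    (hX : IsCompact X) (hXd : IsTotallyDisconnected X) (hV : IsOpen V) {x : E} (hxX : x ∈ X)
    (hxV : x ∈ V) : ∃ T ⊆ X ∩ V, x ∈ T ∧ IsClosed T ∧ IsClosed (X \ T) := by
  have := isCompact_iff_compactSpace.1 hX
  have := totallyDisconnectedSpace_subtype_iff.2 hXd
  obtain ⟨T, hT, hxT, hTV⟩ := compact_exists_isClopen_in_isOpen
    (hV.preimage (continuous_subtype_val (p := (· ∈ X)))) (show (⟨x, hxX⟩ : X) ∈ _ from hxV)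
  have hemb := hX.isClosed.isClosedEmbedding_subtypeVal
  refine ⟨Subtype.val '' T, ?_, ⟨_, hxT, rfl⟩, hemb.isClosedMap _ hT.isClosed, ?_⟩
  · rintro _ ⟨z, hz, rfl⟩
    exact ⟨z.2, hTV hz⟩
  · convert hemb.isClosedMap _ hT.compl.isClosed using 1
    ext z
    simp +contextual

/-- If every point of a compact totally disconnected set has a neighbourhood whose closed subsets
do not separate `p` from `q`, then neither does the whole set. -/
theorem notSeparates_of_isTotallyDisconnected [SimplyConnectedSpace E]
    [LocallyPathConnectedSpace E] [T2Space E] [NormalSpace E] {X : Set E} {p q : E}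
    (hX : IsCompact X) (hXd : IsTotallyDisconnected X) (hpX : p ∉ X)
    (hloc : ∀ x ∈ X, ∃ V, IsOpen V ∧ x ∈ V ∧
      ∀ K, IsClosed K → K ⊆ V → NotSeparates K p q) : NotSeparates X p q := by
  suffices h : ∃ T ⊆ X, X ⊆ T ∧ IsClosed T ∧ IsClosed (X \ T) ∧
      ∀ K, IsClosed K → K ⊆ T → NotSeparates K p q by
    obtain ⟨T, -, hXT, -, -, hT⟩ := h
    exact hT X hX.isClosed hXT
  refine hX.induction_on (p := fun S => ∃ T ⊆ X, S ⊆ T ∧ IsClosed T ∧ IsClosed (X \ T) ∧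
      ∀ K, IsClosed K → K ⊆ T → NotSeparates K p q) ?_ ?_ ?_ ?_
  · refine ⟨∅, empty_subset _, Subset.rfl, isClosed_empty, by simpa using hX.isClosed, ?_⟩
    intro K _ hK
    rw [subset_empty_iff.1 hK]
    exact notSeparates_empty p q
  · rintro S S' hSS' ⟨T, hTX, hT, h⟩
    exact ⟨T, hTX, hSS'.trans hT, h⟩
  · rintro S S' ⟨T, hTX, hST, hT, hTc, h⟩ ⟨T', hTX', hST', hT', hTc', h'⟩
    refine ⟨T ∪ T', union_subset hTX hTX', union_subset_union hST hST', hT.union hT', ?_, ?_⟩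
    · rw [← sdiff_inter_sdiff]
      exact hTc.inter hTc'
    · intro K hK hKT
      have hKX : K ⊆ X := hKT.trans (union_subset hTX hTX')
      have hKd : IsClosed (K \ T) := by
        rw [← inter_eq_left.2 hKX, inter_sdiff_assoc]
        exact hK.inter hTc
      rw [← inter_union_sdiff K T]
      refine NotSeparates.union (hK.inter hT) hKd (disjoint_sdiff_right.mono_left inter_subset_right)
        (fun hp => hpX (hKX hp.1)) (fun hp => hpX (hKX hp.1))
        (h _ (hK.inter hT) inter_subset_right) (h' _ hKd ?_)
      exact fun z hz => (hKT hz.1).resolve_left hz.2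
  · intro x hx
    obtain ⟨V, hV, hxV, h⟩ := hloc x hx
    obtain ⟨T, hTXV, hxT, hT, hTc⟩ :=
      exists_isClosed_diff_subset_of_isTotallyDisconnected hX hXd hV hx hxV
    refine ⟨T, ?_, T, hTXV.trans inter_subset_left, Subset.rfl, hT, hTc, fun K hK hKT =>
      h K hK (hKT.trans (hTXV.trans inter_subset_right))⟩
    filter_upwards [inter_mem_nhdsWithin X (hTc.isOpen_compl.mem_nhds fun hx' => hx'.2 hxT)]
      with z hz
    by_contra hzT
    exact hz.2 ⟨hz.1, hzT⟩

end TopologicalSpace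

section NormedSpace

variable {E : Type*} [NormedAddCommGroup E] [NormedSpace ℝ E]

theorem isPreconnected_compl_closedBall_of_one_lt_rank (h : 1 < Module.rank ℝ E) (x : E) {r : ℝ}
    (hr : 0 ≤ r) : IsPreconnected (closedBall x r)ᶜ := by
  have himage : (fun y : E => x + (1 + r * ‖y‖⁻¹) • y) '' {0}ᶜ = (closedBall x r)ᶜ := by
    ext z
    simp only [mem_image, mem_compl_iff, mem_singleton_iff, mem_closedBall, not_le]
    constructor
    · rintro ⟨y, hy, rfl⟩
      have hy' : 0 < ‖y‖ := norm_pos_iff.2 hy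
      rw [dist_eq_norm, add_sub_cancel_left, norm_smul, Real.norm_of_nonneg (by positivity)]
      field_simp
      linarith
    · intro hz
      rw [dist_eq_norm] at hz
      have hz' : 0 < ‖z - x‖ := hr.trans_lt hz
      have hd : 0 < ‖z - x‖ - r := sub_pos.2 hz
      have hc : 0 < 1 - r * ‖z - x‖⁻¹ := by
        rw [← div_eq_mul_inv, sub_pos, div_lt_one hz']
        exact hz
      have hnorm : ‖(1 - r * ‖z - x‖⁻¹) • (z - x)‖ = ‖z - x‖ - r := by
        rw [norm_smul, Real.norm_of_nonneg hc.le]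
        field_simp
      refine ⟨(1 - r * ‖z - x‖⁻¹) • (z - x), norm_pos_iff.1 (hnorm ▸ hd), ?_⟩
      rw [hnorm, smul_smul]
      have hone : (1 + r * (‖z - x‖ - r)⁻¹) * (1 - r * ‖z - x‖⁻¹) = 1 := by
        field_simp
        ring
      rw [hone, one_smul, add_sub_cancel]
  rw [← himage]
  refine (isConnected_compl_singleton_of_one_lt_rank h (0 : E)).isPreconnected.image _ ?_
  refine continuousOn_const.add (ContinuousOn.smul (continuousOn_const.add
    (continuousOn_const.mul (continuousOn_id.norm.inv₀ ?_))) continuousOn_id)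
  exact fun y hy => norm_ne_zero_iff.2 hy

theorem isPreconnected_compl_of_isTotallyDisconnected (h : 1 < Module.rank ℝ E) {X : Set E}
    (hX : IsCompact X) (hXd : IsTotallyDisconnected X) : IsPreconnected Xᶜ := by
  refine isPreconnected_compl_of_notSeparates hX.isClosed fun p hp q hq =>
    notSeparates_of_isTotallyDisconnected hX hXd hp fun x hx => ?_
  have hxp : 0 < dist p x := dist_pos.2 fun hpx => hp (hpx ▸ hx)
  have hxq : 0 < dist q x := dist_pos.2 fun hqx => hq (hqx ▸ hx)
  obtain ⟨r, hr, hrd⟩ := exists_between (lt_min hxp hxq)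
  refine ⟨ball x r, isOpen_ball, mem_ball_self hr, fun K _ hK => ?_⟩
  refine .of_isPreconnected (isPreconnected_compl_closedBall_of_one_lt_rank h x hr.le)
    (disjoint_compl_left.mono_right (hK.trans ball_subset_closedBall)) ?_ ?_
  · simpa using hrd.trans_le (min_le_left _ _)
  · simpa using hrd.trans_le (min_le_right _ _)

end NormedSpace

/-- If `n ≥ 2` and `X ⊂ ℝ^n` is a Cantor set, then `ℝ^n \ X` is connected. -/
theorem compl_cantorSet_isConnected (n : ℕ) (hn : 2 ≤ n)
    (X : Set (EuclideanSpace ℝ (Fin n))) (hX : IsCantorSet X) :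
    IsConnected Xᶜ := by
  obtain ⟨-, hXc, -, hXd⟩ := hX
  have hrank : 1 < Module.rank ℝ (EuclideanSpace ℝ (Fin n)) := by
    rw [← Module.finrank_eq_rank, finrank_euclideanSpace_fin]
    exact_mod_cast hn
  have : Nontrivial (EuclideanSpace ℝ (Fin n)) :=
    (rank_pos_iff_nontrivial (R := ℝ)).1 (zero_lt_one.trans hrank)
  have : NoncompactSpace (EuclideanSpace ℝ (Fin n)) := NormedSpace.noncompactSpace ℝ _
  exact ⟨nonempty_compl.2 hXc.ne_univ, isPreconnected_compl_of_isTotallyDisconnected hrank hXc hXd⟩
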